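/- For every positive integer n, Σ_{σ ∈ S_n} q^{inv σ − exc σ} t^{exc σ} = Σ_{σ ∈ S_n} q^{2·res σ + les σ} t^{des σ}, as polynomials in q and t; i.e., S_n(q, t/q) equals the specialization A_n(q², q, t) of the generalized Eulerian polynomial. -/

import Mathlib

open Finset MvPolynomial

/-- The value `σ(i)` for a permutation of `{1,…,n}` encoded as `Equiv.Perm (Fin n)`,
with the convention `σ(i) = 0` for `i = 0` and `i = n+1` (indeed for all `i ∉ [n]`). -/
def pval (n : ℕ) (σ : Equiv.Perm (Fin n)) (i : ℕ) : ℕ :=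
  if h : 1 ≤ i ∧ i ≤ n then ((σ ⟨i - 1, by omega⟩ : Fin n) : ℕ) + 1 else 0

/-- Number of inversions: pairs `1 ≤ i < j ≤ n` with `σ(i) > σ(j)`. -/
def inv (n : ℕ) (σ : Equiv.Perm (Fin n)) : ℕ :=
  ((Finset.Icc 1 n ×ˢ Finset.Icc 1 n).filter
    (fun p => p.1 < p.2 ∧ pval n σ p.2 < pval n σ p.1)).card

/-- Number of excedances: indices `i ∈ [n]` with `i < σ(i)`. -/
def exc (n : ℕ) (σ : Equiv.Perm (Fin n)) : ℕ :=
  ((Finset.Icc 1 n).filter (fun i => i < pval n σ i)).card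

/-- Number of drops: indices `i ∈ [n]` with `i > σ(i)`. -/
def drp (n : ℕ) (σ : Equiv.Perm (Fin n)) : ℕ :=
  ((Finset.Icc 1 n).filter (fun i => pval n σ i < i)).card

/-- Number of descents: indices `1 ≤ i < n` with `σ(i) > σ(i+1)`. -/
def des (n : ℕ) (σ : Equiv.Perm (Fin n)) : ℕ :=
  ((Finset.Icc 1 (n - 1)).filter (fun i => pval n σ (i + 1) < pval n σ i)).card

/-- `les σ`: number of pairs `2 ≤ i < j ≤ n` with `σ(i-1) > σ(j) > σ(i)`. -/
def les (n : ℕ) (σ : Equiv.Perm (Fin n)) : ℕ :=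
  ((Finset.Icc 2 n ×ˢ Finset.Icc 2 n).filter
    (fun p => p.1 < p.2 ∧ pval n σ p.2 < pval n σ (p.1 - 1) ∧
      pval n σ p.1 < pval n σ p.2)).card

/-- `res σ`: number of pairs `1 ≤ i < j ≤ n-1` with `σ(j+1) > σ(i) > σ(j)`. -/
def res (n : ℕ) (σ : Equiv.Perm (Fin n)) : ℕ :=
  ((Finset.Icc 1 (n - 1) ×ˢ Finset.Icc 1 (n - 1)).filter
    (fun p => p.1 < p.2 ∧ pval n σ p.2 < pval n σ p.1 ∧
      pval n σ p.1 < pval n σ (p.2 + 1))).card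

/-- `ress σ`: number of pairs `1 ≤ i < j ≤ n-1` with `σ(j+1) < σ(i) < σ(j)`. -/
def ress (n : ℕ) (σ : Equiv.Perm (Fin n)) : ℕ :=
  ((Finset.Icc 1 (n - 1) ×ˢ Finset.Icc 1 (n - 1)).filter
    (fun p => p.1 < p.2 ∧ pval n σ (p.2 + 1) < pval n σ p.1 ∧
      pval n σ p.1 < pval n σ p.2)).card

/-- Crossing number: pairs `(i,j) ∈ [n]×[n]` with `i < j ≤ σ(i) < σ(j)` or
`i > j > σ(i) > σ(j)`. -/
def cros (n : ℕ) (σ : Equiv.Perm (Fin n)) : ℕ :=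
  ((Finset.Icc 1 n ×ˢ Finset.Icc 1 n).filter
    (fun p => (p.1 < p.2 ∧ p.2 ≤ pval n σ p.1 ∧ pval n σ p.1 < pval n σ p.2) ∨
      (p.2 < p.1 ∧ pval n σ p.1 < p.2 ∧ pval n σ p.2 < pval n σ p.1))).card

/-- Nesting number: pairs `(i,j) ∈ [n]×[n]` with `i < j ≤ σ(j) < σ(i)` or
`i > j > σ(j) > σ(i)`. -/
def nest (n : ℕ) (σ : Equiv.Perm (Fin n)) : ℕ :=
  ((Finset.Icc 1 n ×ˢ Finset.Icc 1 n).filter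
    (fun p => (p.1 < p.2 ∧ p.2 ≤ pval n σ p.2 ∧ pval n σ p.2 < pval n σ p.1) ∨
      (p.2 < p.1 ∧ pval n σ p.2 < p.2 ∧ pval n σ p.1 < pval n σ p.2))).card

/-- Number of valleys: `i ∈ [n]` with `σ(i-1) > σ(i)` and `σ(i) < σ(i+1)`
(convention `σ(0) = σ(n+1) = 0`). -/
def valleys (n : ℕ) (σ : Equiv.Perm (Fin n)) : ℕ :=
  ((Finset.Icc 1 n).filter
    (fun i => pval n σ i < pval n σ (i - 1) ∧ pval n σ i < pval n σ (i + 1))).card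

/-- Number of double descents: `i ∈ [n]` with `σ(i-1) > σ(i)` and `σ(i) > σ(i+1)`
(convention `σ(0) = σ(n+1) = 0`). -/
def ddes (n : ℕ) (σ : Equiv.Perm (Fin n)) : ℕ :=
  ((Finset.Icc 1 n).filter
    (fun i => pval n σ i < pval n σ (i - 1) ∧ pval n σ (i + 1) < pval n σ i)).card

/-- `S_{n,k}`: permutations of `[n]` with exactly `k` valleys and no double descents. -/
def Snk (n k : ℕ) : Finset (Equiv.Perm (Fin n)) :=
  Finset.univ.filter (fun σ => valleys n σ = k ∧ ddes n σ = 0)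

/-- The permutation of `Fin (N + 1)` sending `r` to `c` and restricting to `τ` off `r`. -/
def insertPerm {N : ℕ} (r c : Fin (N + 1)) (τ : Equiv.Perm (Fin N)) : Equiv.Perm (Fin (N + 1)) :=
  (finSuccEquiv' r).trans ((Equiv.optionCongr τ).trans (finSuccEquiv' c).symm)

lemma insertPerm_self {N : ℕ} (r c : Fin (N + 1)) (τ : Equiv.Perm (Fin N)) :
    insertPerm r c τ r = c := by
  simp [insertPerm]

lemma insertPerm_succAbove {N : ℕ} (r c : Fin (N + 1)) (τ : Equiv.Perm (Fin N)) (i : Fin N) :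
    insertPerm r c τ (r.succAbove i) = c.succAbove (τ i) := by
  simp [insertPerm]

lemma insertPerm_injective {N : ℕ} (r c : Fin (N + 1)) :
    Function.Injective (insertPerm r c) := by
  intro τ τ' h
  ext i
  have := congrArg (fun σ => σ (r.succAbove i)) h
  simp only [insertPerm_succAbove] at this
  exact congrArg _ (Fin.succAbove_right_injective this)

lemma sum_perm_by_image {N : ℕ} {R : Type*} [AddCommMonoid R] (r : Fin (N + 1))
    (f : Equiv.Perm (Fin (N + 1)) → R) :
    ∑ σ, f σ = ∑ c, ∑ τ, f (insertPerm r c τ) := by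
  rw [← Fintype.sum_prod_type' (f := fun c τ => f (insertPerm r c τ))]
  refine (Fintype.sum_bijective (fun x : Fin (N + 1) × Equiv.Perm (Fin N) => insertPerm r x.1 x.2)
    ?_ _ _ fun _ => rfl).symm
  rw [Fintype.bijective_iff_injective_and_card]
  refine ⟨?_, by simp [Fintype.card_perm, Nat.factorial_succ]⟩
  rintro ⟨c, τ⟩ ⟨c', τ'⟩ h
  have hc : c = c' := by simpa [insertPerm_self] using congrArg (fun σ => σ r) h
  subst hc
  rw [insertPerm_injective r c (a₁ := τ) (a₂ := τ') h]

lemma sum_perm_by_preimage {N : ℕ} {R : Type*} [AddCommMonoid R] (c : Fin (N + 1))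
    (f : Equiv.Perm (Fin (N + 1)) → R) :
    ∑ σ, f σ = ∑ r, ∑ τ, f (insertPerm r c τ) := by
  rw [← Fintype.sum_prod_type' (f := fun r τ => f (insertPerm r c τ))]
  refine (Fintype.sum_bijective (fun x : Fin (N + 1) × Equiv.Perm (Fin N) => insertPerm x.1 c x.2)
    ?_ _ _ fun _ => rfl).symm
  rw [Fintype.bijective_iff_injective_and_card]
  refine ⟨?_, by simp [Fintype.card_perm, Nat.factorial_succ]⟩
  rintro ⟨r, τ⟩ ⟨r', τ'⟩ h
  have hr : r = r' := by
    have h' : insertPerm r c τ = insertPerm r' c τ' := h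
    apply (insertPerm r c τ).injective
    rw [insertPerm_self, h', insertPerm_self]
  subst hr
  rw [insertPerm_injective r c (a₁ := τ) (a₂ := τ') h]

/-- The inversion number of a permutation of `Fin N`. -/
def finInv {N : ℕ} (σ : Equiv.Perm (Fin N)) : ℕ :=
  ∑ i, ∑ j, if i < j ∧ σ j < σ i then 1 else 0

lemma sum_lt_indicator {N : ℕ} (c : Fin (N + 1)) :
    (∑ j : Fin N, if c.succAbove j < c then 1 else 0) = (c : ℕ) := by
  have h := Fin.sum_univ_succAbove (fun j : Fin (N + 1) => if j < c then 1 else 0) c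
  simp only [lt_irrefl, if_false, zero_add] at h
  rw [← h, sum_boole, Finset.filter_gt_eq_Iio, Fin.card_Iio, Nat.cast_id]

lemma finInv_insertPerm {N : ℕ} (r c : Fin (N + 1)) (τ : Equiv.Perm (Fin N))
    (h : ∀ i, r.succAbove i < r → ¬ c.succAbove (τ i) < c) :
    finInv (insertPerm r c τ) = r + c + finInv τ := by
  unfold finInv
  rw [Fin.sum_univ_succAbove _ r, Fin.sum_univ_succAbove _ r]
  simp only [Fin.sum_univ_succAbove _ r, insertPerm_self, insertPerm_succAbove,
    Fin.succAbove_lt_succAbove_iff, sum_add_distrib, lt_irrefl, false_and, if_false, zero_add]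
  have h1 : (∑ i : Fin N, if r < r.succAbove i ∧ c.succAbove (τ i) < c then 1 else 0)
      = (c : ℕ) := by
    rw [← sum_lt_indicator c, ← Equiv.sum_comp τ fun j => if c.succAbove j < c then 1 else 0]
    refine sum_congr rfl fun i _ => if_congr ⟨fun h => h.2, fun h' => ⟨?_, h'⟩⟩ rfl rfl
    by_contra h''
    exact h i (lt_of_le_of_ne (not_lt.1 h'') (Fin.succAbove_ne _ _)) h'
  have h2 : (∑ i : Fin N, if r.succAbove i < r ∧ c < c.succAbove (τ i) then 1 else 0)
      = (r : ℕ) := by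
    rw [← sum_lt_indicator r]
    refine sum_congr rfl fun i _ => if_congr ⟨fun h => h.1, fun h' => ⟨h', ?_⟩⟩ rfl rfl
    exact lt_of_le_of_ne (not_lt.1 (h i h')) (Fin.succAbove_ne _ _).symm
  rw [h1, h2]
  ring

/-- The inversion-weighted permanent of the top-left `N × N` corner of `M`. -/
def qPermanent {R : Type*} [CommSemiring R] (q : R) (N : ℕ) (M : ℕ → ℕ → R) : R :=
  ∑ σ : Equiv.Perm (Fin N), q ^ finInv σ * ∏ i : Fin _, M i (σ i)

/-- Delete row `r` and column `c`. -/
def minor {R : Type*} (r c : ℕ) (M : ℕ → ℕ → R) : ℕ → ℕ → R :=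
  fun i j => M (if i < r then i else i + 1) (if j < c then j else j + 1)

lemma succAbove_val {N : ℕ} (r : Fin (N + 1)) (i : Fin N) :
    (r.succAbove i : ℕ) = if (i : ℕ) < r then (i : ℕ) else i + 1 := by
  rw [Fin.succAbove]
  simp only [Fin.lt_def, Fin.val_castSucc]
  split_ifs <;> simp

lemma sum_insertPerm {R : Type*} [CommSemiring R] (q : R) {N : ℕ} (M : ℕ → ℕ → R)
    (r c : Fin (N + 1)) (h : ∀ i j : ℕ, i < r → j < c → M i j = 0) :
    ∑ τ, (q ^ finInv (insertPerm r c τ) * ∏ i : Fin _, M i (insertPerm r c τ i)) =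
      q ^ ((r : ℕ) + c) * M r c * qPermanent q N (minor r c M) := by
  rw [qPermanent, mul_sum]
  refine sum_congr rfl fun τ _ => ?_
  rw [Fin.prod_univ_succAbove _ r, insertPerm_self]
  simp only [insertPerm_succAbove]
  have hm : ∏ i, M (r.succAbove i) (c.succAbove (τ i)) = ∏ i : Fin _, minor r c M i (τ i) := by
    refine prod_congr rfl fun i _ => ?_
    rw [minor, succAbove_val, succAbove_val]
  rw [← hm]
  by_cases hz : ∀ i, r.succAbove i < r → ¬ c.succAbove (τ i) < c
  · rw [finInv_insertPerm _ _ _ hz]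
    ring
  · push Not at hz
    obtain ⟨i, hi, hj⟩ := hz
    rw [prod_eq_zero (mem_univ i) (h _ _ hi hj)]
    ring

lemma sum_fin_lt {R : Type*} [AddCommMonoid R] {N k : ℕ} (hk : k ≤ N) (f : ℕ → R) :
    (∑ c : Fin N, if (c : ℕ) < k then f c else 0) = ∑ c ∈ range k, f c := by
  rw [Fin.sum_univ_eq_sum_range (fun c => if c < k then f c else 0), ← sum_filter]
  congr 1
  ext c
  simp only [mem_filter, mem_range]
  omega

lemma qPermanent_row {R : Type*} [CommSemiring R] (q : R) {N r k : ℕ} (hr : r < N + 1)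
    (hk : k ≤ N + 1) (M M' : ℕ → ℕ → R) (h : ∀ i j, i < r → j < k → M i j = 0)
    (h1 : ∀ i j, i ≠ r → M' i j = M i j) (h2 : ∀ j, j < k → M' r j = 0)
    (h3 : ∀ j, k ≤ j → M' r j = M r j) :
    qPermanent q (N + 1) M = qPermanent q (N + 1) M' +
      ∑ c ∈ range k, q ^ (r + c) * M r c * qPermanent q N (minor r c M) := by
  rw [← sum_fin_lt hk, qPermanent, qPermanent, sum_perm_by_image ⟨r, hr⟩,
    sum_perm_by_image ⟨r, hr⟩, ← sum_add_distrib]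
  refine sum_congr rfl fun c _ => ?_
  split_ifs with hc
  · rw [sum_insertPerm q M _ _ fun i j hi hj => h i j hi (hj.trans hc), sum_eq_zero, zero_add]
    intro τ _
    rw [prod_eq_zero (mem_univ (⟨r, hr⟩ : Fin (N + 1))), mul_zero]
    rw [insertPerm_self]
    exact h2 _ hc
  · rw [add_zero]
    refine sum_congr rfl fun τ _ => ?_
    congr 1
    refine prod_congr rfl fun i _ => ?_
    by_cases hi : i = ⟨r, hr⟩
    · subst hi
      rw [insertPerm_self]
      exact (h3 _ (not_lt.1 hc)).symm
    · exact (h1 _ _ fun h' => hi (Fin.ext h')).symm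

lemma qPermanent_col {R : Type*} [CommSemiring R] (q : R) {N c k : ℕ} (hc : c < N + 1)
    (hk : k ≤ N + 1) (M M' : ℕ → ℕ → R) (h : ∀ i j, i < k → j < c → M i j = 0)
    (h1 : ∀ i j, j ≠ c → M' i j = M i j) (h2 : ∀ i, i < k → M' i c = 0)
    (h3 : ∀ i, k ≤ i → M' i c = M i c) :
    qPermanent q (N + 1) M = qPermanent q (N + 1) M' +
      ∑ r ∈ range k, q ^ (r + c) * M r c * qPermanent q N (minor r c M) := by
  rw [← sum_fin_lt hk, qPermanent, qPermanent, sum_perm_by_preimage ⟨c, hc⟩,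
    sum_perm_by_preimage ⟨c, hc⟩, ← sum_add_distrib]
  refine sum_congr rfl fun r _ => ?_
  split_ifs with hr
  · rw [sum_insertPerm q M _ _ fun i j hi hj => h i j (hi.trans hr) hj, sum_eq_zero, zero_add]
    intro τ _
    rw [prod_eq_zero (mem_univ r), mul_zero]
    rw [insertPerm_self]
    exact h2 _ hr
  · rw [add_zero]
    refine sum_congr rfl fun τ _ => ?_
    congr 1
    refine prod_congr rfl fun i _ => ?_
    by_cases hi : i = r
    · subst hi
      rw [insertPerm_self]
      exact (h3 _ (not_lt.1 hr)).symm
    · refine (h1 _ _ fun heq => hi ?_).symm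
      apply (insertPerm r ⟨c, hc⟩ τ).injective
      rw [insertPerm_self]
      exact Fin.ext heq

/-- Entries `u` above the diagonal and `1` elsewhere, with a zero `h × h` block in the corner. -/
def excMatrix {R : Type*} [CommSemiring R] (u : R) (h : ℕ) : ℕ → ℕ → R :=
  fun i j => if i < h ∧ j < h then 0 else if i < j then u else 1

/-- The generating function of inversions and excedances with no entry in the corner block. -/
def excPoly {R : Type*} [CommSemiring R] (q u : R) (m h : ℕ) : R :=
  qPermanent q (m + h) (excMatrix u h)

lemma excPoly_zero {R : Type*} [CommSemiring R] (q u : R) (h : ℕ) :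
    excPoly q u 0 h = if h = 0 then 1 else 0 := by
  unfold excPoly qPermanent
  split_ifs with h0
  · subst h0
    simp [finInv]
  · refine sum_eq_zero fun σ _ => ?_
    rw [prod_eq_zero (mem_univ (⟨0, by omega⟩ : Fin (0 + h))), mul_zero]
    simp only [excMatrix]
    rw [if_pos]
    constructor <;> omega

lemma excPoly_succ {R : Type*} [CommSemiring R] (q u : R) (m h : ℕ) :
    excPoly q u (m + 1) h = excPoly q u m (h + 1)
      + (q ^ (2 * h) + (1 + u) * ∑ r ∈ range h, q ^ (r + h)) * excPoly q u m h
      + u * (∑ r ∈ range h, q ^ (r + h)) * (∑ r ∈ range h, q ^ (r + (h - 1)))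
        * excPoly q u m (h - 1) := by
  have hN : m + 1 + h = (m + h) + 1 := by ring
  -- the matrix with the row `h` also avoiding the first `h` columns
  let A : ℕ → ℕ → R := fun i j => if i < h + 1 ∧ j < h then 0 else if i < j then u else 1
  have row := qPermanent_row q (N := m + h) (r := h) (k := h) (by omega) (by omega)
    (excMatrix u h) A (by intro i j hi hj; simp [excMatrix, hi, hj])
    (by
      intro i j hi
      simp only [A, excMatrix]
      exact if_congr (by omega) rfl rfl)
    (by intro j hj; simp [A, hj])
    (by
      intro j hj
      simp only [A, excMatrix]
      grind)
  have col := qPermanent_col q (N := m + h) (c := h) (k := h + 1) (by omega) (by omega)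
    A (excMatrix u (h + 1)) (by intro i j hi hj; simp only [A]; grind)
    (by
      intro i j hj
      simp only [A, excMatrix]
      exact if_congr (by omega) rfl rfl)
    (by intro i hi; simp [excMatrix, hi])
    (by
      intro i hi
      simp only [A, excMatrix]
      grind)
  have hA : ∀ r < h + 1, minor r h A = excMatrix u h := by
    intro r hr
    ext i j
    simp only [minor, A, excMatrix]
    grind
  rw [sum_range_succ, sum_congr rfl (g := fun r => q ^ (r + h) * (u * excPoly q u m h))
    (by
      intro r hr
      rw [mem_range] at hr
      rw [hA r (by omega), excPoly, mul_assoc]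
      congr 2
      simp only [A]
      rw [if_neg (by omega), if_pos hr]), hA h (by omega), ← sum_mul] at col
  have hAh : A h h = 1 := by simp [A]
  rw [hAh] at col
  -- the matrix left after the row `h` was matched to one of the first `h` columns
  let B : ℕ → ℕ → R := fun i j =>
    if i < h ∧ j < h - 1 then 0 else if i < h ∨ i < j then u else 1
  have hB : ∀ c < h, minor h c (excMatrix u h) = B := by
    intro c hc
    ext i j
    simp only [minor, B, excMatrix]
    grind
  rw [sum_congr rfl (g := fun c => q ^ (c + h) * qPermanent q (m + h) B)
    (by
      intro c hc
      rw [mem_range] at hc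
      rw [hB c hc, add_comm h c]
      simp only [excMatrix]
      rw [if_neg (by omega), if_neg (by omega), mul_one]), ← sum_mul] at row
  have hBs : (∑ r ∈ range h, q ^ (r + h)) * qPermanent q (m + h) B =
      (∑ r ∈ range h, q ^ (r + h)) * (excPoly q u m h +
        u * (∑ r ∈ range h, q ^ (r + (h - 1))) * excPoly q u m (h - 1)) := by
    rcases h with _ | g
    · simp
    congr 1
    have col' := qPermanent_col q (N := m + g) (c := g) (k := g + 1) (by omega) (by omega)
      B (excMatrix u (g + 1)) (by intro i j hi hj; simp only [B]; grind)
      (by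
        intro i j hj
        simp only [B, excMatrix]
        grind)
      (by intro i hi; simp [excMatrix, hi])
      (by
        intro i hi
        simp only [B, excMatrix]
        grind)
    have hB' : ∀ r < g + 1, minor r g B = excMatrix u g := by
      intro r hr
      ext i j
      simp only [minor, B, excMatrix]
      grind
    rw [sum_congr rfl (g := fun r => q ^ (r + g) * (u * excPoly q u m g))
      (by
        intro r hr
        rw [mem_range] at hr
        rw [hB' r hr, excPoly, mul_assoc]
        congr 2
        simp only [B]
        rw [if_neg (by omega), if_pos (by omega)]), ← sum_mul] at col'
    rw [← add_assoc, col']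
    simp only [excPoly, Nat.add_sub_cancel]
    rw [← add_assoc]
    ring
  rw [excPoly, hN, row, col, hBs]
  have e : qPermanent q (m + h + 1) (excMatrix u (h + 1)) = excPoly q u m (h + 1) := rfl
  have e' : qPermanent q (m + h) (excMatrix u h) = excPoly q u m h := rfl
  rw [e, e', two_mul]
  ring

/-- The number of adjacent entries `x, y` of `l` with `x > z > y`. -/
def descentsAcross (z : ℕ) : List ℕ → ℕ
  | x :: y :: l => (if z < x ∧ y < z then 1 else 0) + descentsAcross z (y :: l)
  | _ => 0

lemma descentsAcross_append_cons {z b : ℕ} (hb : b < z) (x y : List ℕ) :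
    descentsAcross z (x ++ b :: y) = descentsAcross z (x ++ [0]) + descentsAcross z (b :: y) := by
  induction x with
  | nil => simp [descentsAcross]
  | cons c x ih =>
    rcases x with _ | ⟨d, x⟩
    · simp only [List.cons_append, List.nil_append, descentsAcross]
      grind
    · simp only [List.cons_append, descentsAcross] at ih ⊢
      omega

lemma descentsAcross_small_append {z : ℕ} (r y : List ℕ) (hr : ∀ b ∈ r, b < z)
    (h0 : r ≠ []) : descentsAcross z (r ++ y) = descentsAcross z (0 :: y) := by
  induction r with
  | nil => exact absurd rfl h0
  | cons c r ih =>
    rcases r with _ | ⟨d, r⟩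
    · have := hr c (by simp)
      rcases y with _ | ⟨d, y⟩
      · simp [descentsAcross]
      · simp only [List.cons_append, List.nil_append, descentsAcross]
        grind
    · have h1 := hr c (by simp)
      rw [← ih (fun b hb => hr b (by simp [hb])) (by simp)]
      simp only [List.cons_append, descentsAcross]
      grind

lemma descentsAcross_replace {z : ℕ} (hz : 0 < z) (x r y : List ℕ) (hr : ∀ b ∈ r, b < z)
    (h0 : r ≠ []) : descentsAcross z (x ++ (r ++ y)) = descentsAcross z (x ++ 0 :: y) := by
  obtain ⟨b, r', rfl⟩ := List.exists_cons_of_ne_nil h0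
  rw [List.cons_append, descentsAcross_append_cons (hr b (by simp)),
    descentsAcross_append_cons hz x y, ← List.cons_append, descentsAcross_small_append _ _ hr h0]

lemma descentsAcross_cons {a c : ℕ} {u : List ℕ} (ha : 0 < a)
    (hc : (c :: u).IsChain (fun x y => x ≠ 0 ∨ y ≠ 0)) (h : ∀ b ∈ c :: u, b = 0 ∨ a < b) :
    descentsAcross a (c :: u) = u.count 0 := by
  induction u generalizing c with
  | nil => simp [descentsAcross]
  | cons d u ih =>
    rw [List.isChain_cons_cons] at hc
    rw [descentsAcross, ih hc.2 fun b hb => h b (by simp [hb]), List.count_cons]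
    have h1 := h c (by simp)
    have h2 := h d (by simp)
    grind

/-- Whether the first entry of `v` is smaller than `z`. -/
def headBelow (z : ℕ) : List ℕ → ℕ
  | b :: _ => if b < z then 1 else 0
  | [] => 0

/-- The weight of a letter `z` having `u` to its left and `v` to its right. -/
def letterWeight {R : Type*} [CommSemiring R] (p q t : R) (z : ℕ) (u v : List ℕ) : R :=
  q ^ descentsAcross z u * p ^ descentsAcross z v.reverse * t ^ headBelow z v

/-- The weight of the letter `z` in the word `w`. -/
def weightAt {R : Type*} [CommSemiring R] (p q t : R) (w : List ℕ) (z : ℕ) : R :=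
  letterWeight p q t z (w.takeWhile (· ≠ z)) (w.dropWhile (· ≠ z)).tail

lemma weightAt_append {R : Type*} [CommSemiring R] (p q t : R) {z : ℕ} {u : List ℕ}
    (hu : z ∉ u) (v : List ℕ) : weightAt p q t (u ++ z :: v) z = letterWeight p q t z u v := by
  have h : ∀ b ∈ u, decide (b ≠ z) = true := by
    intro b hb
    simp only [ne_eq, decide_eq_true_eq]
    rintro rfl
    exact hu hb
  rw [weightAt, List.takeWhile_append_of_pos h, List.dropWhile_append_of_pos h]
  simp

lemma weightAt_replace {R : Type*} [CommSemiring R] (p q t : R) {z : ℕ} (hz : 0 < z)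
    (x r y : List ℕ) (hr : ∀ b ∈ r, b < z) (h0 : r ≠ []) (h : z ∈ x ++ y) :
    weightAt p q t (x ++ (r ++ y)) z = weightAt p q t (x ++ 0 :: y) z := by
  by_cases hx : z ∈ x
  · obtain ⟨x₁, x₂, rfl, hx₁⟩ := List.eq_append_cons_of_mem hx
    simp only [List.append_assoc, List.cons_append]
    rw [weightAt_append p q t hx₁, weightAt_append p q t hx₁, letterWeight, letterWeight]
    have h1 := descentsAcross_replace hz y.reverse r.reverse x₂.reverse (by simpa using hr)
      (by simpa using h0)
    have h2 : headBelow z (x₂ ++ (r ++ y)) = headBelow z (x₂ ++ 0 :: y) := by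
      rcases x₂ with _ | ⟨c, x₂⟩
      · rcases r with _ | ⟨b, r⟩
        · exact absurd rfl h0
        · simp [headBelow, hz, hr b]
      · rfl
    rw [h2]
    simp only [List.reverse_append, List.reverse_cons, List.append_assoc] at h1 ⊢
    rw [h1]
    simp
  · have hy : z ∈ y := by simpa [hx] using h
    obtain ⟨y₁, y₂, rfl, hy₁⟩ := List.eq_append_cons_of_mem hy
    have hzr : z ∉ r := fun hb => lt_irrefl _ (hr z hb)
    have e1 : x ++ (r ++ (y₁ ++ z :: y₂)) = (x ++ (r ++ y₁)) ++ z :: y₂ := by simp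
    have e2 : x ++ 0 :: (y₁ ++ z :: y₂) = (x ++ 0 :: y₁) ++ z :: y₂ := by simp
    rw [e1, e2, weightAt_append p q t (by simp [hx, hzr, hy₁]),
      weightAt_append p q t (by simp [hx, hy₁, hz.ne']), letterWeight, letterWeight,
      descentsAcross_replace hz _ _ _ hr h0]

/-- The product of the weights of the letters `A` in `w`. -/
def wordWeight {R : Type*} [CommSemiring R] (p q t : R) (A w : List ℕ) : R :=
  (A.map (weightAt p q t w)).prod

/-- All factorizations `w = x ++ 0 :: y`. -/
def zeroSplits : List ℕ → List (List ℕ × List ℕ)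
  | [] => []
  | c :: l => (if c = 0 then [([], l)] else []) ++ (zeroSplits l).map fun s => (c :: s.1, s.2)

lemma mem_zeroSplits {w : List ℕ} {s : List ℕ × List ℕ} :
    s ∈ zeroSplits w ↔ w = s.1 ++ 0 :: s.2 := by
  induction w generalizing s with
  | nil => simp [zeroSplits]
  | cons c l ih =>
    obtain ⟨x, y⟩ := s
    simp only [zeroSplits, List.mem_append, List.mem_map, ih]
    rcases x with _ | ⟨d, x⟩
    · simp only [List.nil_append, List.cons.injEq]
      split_ifs with h <;> simp only [List.mem_singleton, Prod.mk.injEq, List.not_mem_nil] <;>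
        grind
    · simp only [List.cons_append, List.cons.injEq]
      constructor
      · rintro (h | ⟨s, hs, h1, h2⟩)
        · split_ifs at h <;> simp at h
        · grind
      · rintro ⟨rfl, h⟩
        exact Or.inr ⟨(x, y), h, rfl⟩

lemma sum_zeroSplits {R : Type*} [CommSemiring R] (f : ℕ → ℕ → R) (w : List ℕ) :
    ((zeroSplits w).map fun s => f (s.1.count 0) (s.2.count 0)).sum =
      ∑ i ∈ range (w.count 0), f i (w.count 0 - 1 - i) := by
  induction w generalizing f with
  | nil => simp [zeroSplits]
  | cons c l ih =>
    simp only [zeroSplits, List.map_append, List.sum_append, List.map_map, Function.comp_def]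
    by_cases hc : c = 0
    · subst hc
      simp only [if_true, List.map_cons, List.map_nil, List.sum_cons, List.sum_nil,
        List.count_cons_self, List.count_nil]
      rw [ih fun i j => f (i + 1) j, sum_range_succ']
      simp only [Nat.add_sub_cancel, Nat.sub_zero, add_zero]
      rw [add_comm]
      congr 1
      refine sum_congr rfl fun i _ => ?_
      congr 1
      omega
    · simp only [hc, if_false, List.map_nil, List.sum_nil, zero_add, List.count_cons_of_ne hc, ih]

/-- Words starting and ending with `0`, with `k + 1` nonadjacent zeros, whose other letters
are those of `A`. -/
structure IsGapWord (A : List ℕ) (k : ℕ) (w : List ℕ) : Prop where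
  chain : w.IsChain fun x y => x ≠ 0 ∨ y ≠ 0
  head : w.head? = some 0
  last : w.getLast? = some 0
  count_zero : w.count 0 = k + 1
  count : ∀ z ≠ 0, w.count z = A.count z

/-- The gap words, generated by replacing a `0` by `a`, `0 a`, `a 0` or `0 a 0`. -/
def gapWords : List ℕ → ℕ → List (List ℕ)
  | [], k => if k = 0 then [[0]] else []
  | _ :: _, 0 => []
  | a :: A, k + 1 =>
    (gapWords A (k + 2)).flatMap (fun w => (zeroSplits w).flatMap fun s =>
        if s.1 ≠ [] ∧ s.2 ≠ [] then [s.1 ++ ([a] ++ s.2)] else []) ++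
    (gapWords A (k + 1)).flatMap (fun w => (zeroSplits w).flatMap fun s =>
        if s.2 ≠ [] then [s.1 ++ ([0, a] ++ s.2)] else []) ++
    (gapWords A (k + 1)).flatMap (fun w => (zeroSplits w).flatMap fun s =>
        if s.1 ≠ [] then [s.1 ++ ([a, 0] ++ s.2)] else []) ++
    (gapWords A k).flatMap (fun w => (zeroSplits w).flatMap fun s =>
        [s.1 ++ ([0, a, 0] ++ s.2)])

lemma IsGapWord.insert {a k : ℕ} {A x y : List ℕ} (ha : a ≠ 0)
    (h : IsGapWord A k (x ++ 0 :: y)) :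
    (x ≠ [] → y ≠ [] → 0 < k → IsGapWord (a :: A) (k - 1) (x ++ ([a] ++ y))) ∧
    (y ≠ [] → IsGapWord (a :: A) k (x ++ ([0, a] ++ y))) ∧
    (x ≠ [] → IsGapWord (a :: A) k (x ++ ([a, 0] ++ y))) ∧
    IsGapWord (a :: A) (k + 1) (x ++ ([0, a, 0] ++ y)) := by
  obtain ⟨h1, h2, h3, h4, h5⟩ := h
  refine ⟨fun hx hy hk => ⟨?_, ?_, ?_, ?_, ?_⟩, fun hy => ⟨?_, ?_, ?_, ?_, ?_⟩,
    fun hx => ⟨?_, ?_, ?_, ?_, ?_⟩, ⟨?_, ?_, ?_, ?_, ?_⟩⟩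
  all_goals
    rcases List.eq_nil_or_concat x with rfl | ⟨x, c, rfl⟩ <;> rcases y with _ | ⟨d, y⟩ <;>
    simp [List.isChain_append, List.count_cons, List.count_append] at * <;> grind

lemma IsGapWord.collapse {a k : ℕ} {A x y : List ℕ} (ha : a ≠ 0) :
    (IsGapWord (a :: A) k (x ++ ([0, a] ++ y)) → y.head? ≠ some 0 →
      IsGapWord A k (x ++ 0 :: y)) ∧
    (IsGapWord (a :: A) k (x ++ ([a, 0] ++ y)) → x.getLast? ≠ some 0 → IsGapWord A k (x ++ 0 :: y)) ∧
    (IsGapWord (a :: A) (k + 1) (x ++ ([0, a, 0] ++ y)) → IsGapWord A k (x ++ 0 :: y)) ∧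
    (IsGapWord (a :: A) k (x ++ ([a] ++ y)) → x.getLast? ≠ some 0 → y.head? ≠ some 0 →
      IsGapWord A (k + 1) (x ++ 0 :: y)) := by
  refine ⟨fun h hy => ?_, fun h hx => ?_, fun h => ?_, fun h hx hy => ?_⟩
  all_goals
    obtain ⟨h1, h2, h3, h4, h5⟩ := h
    refine ⟨?_, ?_, ?_, ?_, ?_⟩
  all_goals
    rcases List.eq_nil_or_concat x with rfl | ⟨x, c, rfl⟩ <;> rcases y with _ | ⟨d, y⟩ <;>
    simp [List.isChain_append, List.count_cons, List.count_append] at * <;> grind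

lemma IsGapWord.mem {a k : ℕ} {A w : List ℕ} (h : IsGapWord A k w) (ha : a ≠ 0) :
    a ∈ w ↔ a ∈ A := by
  rw [← List.count_pos_iff, h.count a ha, List.count_pos_iff]

lemma IsGapWord.weightAt_min {R : Type*} [CommSemiring R] (p q t : R) {a k : ℕ}
    {A u v : List ℕ} (ha : 0 < a) (hA : ∀ b ∈ A, a < b)
    (h : IsGapWord (a :: A) k (u ++ a :: v)) :
    weightAt p q t (u ++ a :: v) a =
      q ^ (u.count 0 - 1) * p ^ (v.count 0 - 1) * t ^ headBelow a v := by
  have hcount := h.count a ha.ne'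
  have haA : A.count a = 0 := List.count_eq_zero.2 fun h' => lt_irrefl _ (hA a h')
  simp only [List.count_append, List.count_cons_self, haA] at hcount
  have hu : a ∉ u := List.count_eq_zero.1 (by omega)
  have hv : a ∉ v := List.count_eq_zero.1 (by omega)
  have hb : ∀ b, b ∈ u ∨ b ∈ v → b = 0 ∨ a < b := by
    intro b hb
    by_cases h0 : b = 0
    · exact Or.inl h0
    have hb' : b ∈ a :: A := (h.mem h0).1 (by simp only [List.mem_append, List.mem_cons]; tauto)
    rcases List.mem_cons.1 hb' with rfl | hb'
    · tauto
    · exact Or.inr (hA b hb')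
  have hc := h.chain
  rw [List.isChain_append] at hc
  rw [weightAt_append p q t hu, letterWeight]
  have hu0 : u.head? = some 0 := by
    have := h.head
    rcases u with _ | ⟨c, u⟩
    · simp at this
      omega
    · simpa using this
  have hv0 : v.reverse.head? = some 0 := by
    have := h.last
    rcases List.eq_nil_or_concat v with rfl | ⟨v, c, rfl⟩
    · simp at this
      omega
    · have e : u ++ a :: (v ++ [c]) = (u ++ a :: v) ++ [c] := by simp
      rw [List.concat_eq_append, e, List.getLast?_concat] at this
      simpa using this
  have key : ∀ w : List ℕ, w.IsChain (fun x y => x ≠ 0 ∨ y ≠ 0) → w.head? = some 0 →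
      (∀ b ∈ w, b = 0 ∨ a < b) → descentsAcross a w = w.count 0 - 1 := by
    intro w hw hw0 hwb
    rcases w with _ | ⟨c, w⟩
    · simp at hw0
    · obtain rfl : c = 0 := by simpa using hw0
      rw [descentsAcross_cons ha hw hwb]
      simp
  rw [key u hc.1 hu0 fun b h => hb b (Or.inl h), key v.reverse _ hv0 fun b h =>
    hb b (Or.inr (List.mem_reverse.1 h)), List.count_reverse]
  rw [List.isChain_reverse]
  exact (List.IsChain.tail hc.2.1).imp fun x y h => h.symm

lemma IsGapWord.wordWeight_replace {R : Type*} [CommSemiring R] (p q t : R) {a k : ℕ}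
    {A x y : List ℕ} (hA : ∀ b ∈ A, a < b) (h : IsGapWord A k (x ++ 0 :: y)) (r : List ℕ)
    (hr : ∀ b ∈ r, b ≤ a) (h0 : r ≠ []) :
    wordWeight p q t (a :: A) (x ++ (r ++ y)) =
      weightAt p q t (x ++ (r ++ y)) a * wordWeight p q t A (x ++ 0 :: y) := by
  rw [wordWeight, List.map_cons, List.prod_cons, wordWeight]
  congr 2
  refine List.map_congr_left fun z hz => ?_
  have hz0 : 0 < z := (Nat.zero_le a).trans_lt (hA z hz)
  refine weightAt_replace p q t hz0 x r y (fun b hb => (hr b hb).trans_lt (hA z hz)) h0 ?_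
  have := (h.mem hz0.ne').2 hz
  simp only [List.mem_append, List.mem_cons] at this ⊢
  grind

/-- The total weight of the gap words. -/
def gapPoly {R : Type*} [CommSemiring R] (p q t : R) (A : List ℕ) (k : ℕ) : R :=
  ((gapWords A k).map (wordWeight p q t A)).sum

lemma mem_gapWords_cons {a k : ℕ} {A w : List ℕ} :
    w ∈ gapWords (a :: A) (k + 1) ↔ ∃ x y,
      (x ++ 0 :: y ∈ gapWords A (k + 2) ∧ x ≠ [] ∧ y ≠ [] ∧ w = x ++ ([a] ++ y)) ∨
      (x ++ 0 :: y ∈ gapWords A (k + 1) ∧ y ≠ [] ∧ w = x ++ ([0, a] ++ y)) ∨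
      (x ++ 0 :: y ∈ gapWords A (k + 1) ∧ x ≠ [] ∧ w = x ++ ([a, 0] ++ y)) ∨
      (x ++ 0 :: y ∈ gapWords A k ∧ w = x ++ ([0, a, 0] ++ y)) := by
  simp only [gapWords, List.mem_append, List.mem_flatMap, List.mem_ite_nil_right,
    List.mem_singleton, mem_zeroSplits, Prod.exists]
  constructor
  · rintro (((⟨w', hw', x, y, rfl, h⟩ | ⟨w', hw', x, y, rfl, h⟩) | ⟨w', hw', x, y, rfl, h⟩) |
      ⟨w', hw', x, y, rfl, h⟩) <;> exact ⟨x, y, by tauto⟩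
  · rintro ⟨x, y, h | h | h | h⟩
    · exact Or.inl (Or.inl (Or.inl ⟨_, h.1, x, y, rfl, by tauto⟩))
    · exact Or.inl (Or.inl (Or.inr ⟨_, h.1, x, y, rfl, by tauto⟩))
    · exact Or.inl (Or.inr ⟨_, h.1, x, y, rfl, by tauto⟩)
    · exact Or.inr ⟨_, h.1, x, y, rfl, by tauto⟩

lemma mem_gapWords {A : List ℕ} (hA : (0 :: A).Pairwise (· < ·)) {k : ℕ} {w : List ℕ} :
    w ∈ gapWords A k ↔ IsGapWord A k w := by
  induction A generalizing k w with
  | nil =>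
    constructor
    · intro h
      simp only [gapWords] at h
      split_ifs at h with hk
      · obtain rfl := List.mem_singleton.1 h
        subst hk
        exact ⟨by simp, by simp, by simp, by simp, by
          intro z hz
          simp [hz.symm]⟩
      · simp at h
    · intro h
      have hw : ∀ b ∈ w, b = 0 := by
        intro b hb
        by_contra h0
        simpa using (h.mem h0).1 hb
      have h1 := h.chain
      have h2 := h.head
      have h4 := h.count_zero
      rcases w with _ | ⟨c, _ | ⟨d, w⟩⟩
      · simp at h2
      · have := hw c (by simp)
        subst this
        simp at h4
        simp [gapWords, ← h4]
      · have := hw c (by simp)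
        have := hw d (by simp)
        simp_all
  | cons a A ih =>
    have ha : a ≠ 0 := by
      have := (List.pairwise_cons.1 hA).1 a (by simp)
      omega
    have hA' : (0 :: A).Pairwise (· < ·) := by
      simp only [List.pairwise_cons, List.mem_cons] at hA ⊢
      exact ⟨fun b hb => hA.1 b (Or.inr hb), hA.2.2⟩
    replace ih := @ih hA'
    rcases k with _ | k
    · simp only [gapWords, List.not_mem_nil, false_iff]
      intro h
      obtain ⟨u, v, rfl⟩ := List.mem_iff_append.1 ((h.mem ha).2 (by simp))
      obtain ⟨h1, h2, h3, h4, h5⟩ := h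
      rcases u with _ | ⟨c, u⟩ <;> rcases List.eq_nil_or_concat v with rfl | ⟨v, d, rfl⟩ <;>
        simp [List.count_cons, List.count_append] at h2 h3 h4 <;> grind
    rw [mem_gapWords_cons]
    constructor
    · rintro ⟨x, y, ⟨h, hx, hy, rfl⟩ | ⟨h, hy, rfl⟩ | ⟨h, hx, rfl⟩ | ⟨h, rfl⟩⟩
      · exact ((ih.1 h).insert ha).1 hx hy (by omega)
      · exact ((ih.1 h).insert ha).2.1 hy
      · exact ((ih.1 h).insert ha).2.2.1 hx
      · exact ((ih.1 h).insert ha).2.2.2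
    · intro h
      obtain ⟨u, v, rfl⟩ := List.mem_iff_append.1 ((h.mem ha).2 (by simp))
      have hu : u ≠ [] := by
        rintro rfl
        have := h.head
        simp at this
        omega
      have hv : v ≠ [] := by
        rintro rfl
        have := h.last
        simp at this
        omega
      have hl := h.last
      have hh := h.head
      by_cases hu0 : u.getLast? = some 0 <;> by_cases hv0 : v.head? = some 0
      · obtain ⟨x, rfl⟩ := List.getLast?_eq_some_iff.1 hu0
        obtain ⟨y, rfl⟩ := List.head?_eq_some_iff.1 hv0
        refine ⟨x, y, Or.inr (Or.inr (Or.inr ⟨ih.2 ?_, by simp⟩))⟩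
        exact (IsGapWord.collapse ha).2.2.1 (by simpa using h)
      · obtain ⟨x, rfl⟩ := List.getLast?_eq_some_iff.1 hu0
        refine ⟨x, v, Or.inr (Or.inl ⟨ih.2 ?_, hv, by simp⟩)⟩
        exact (IsGapWord.collapse ha).1 (by simpa using h) hv0
      · obtain ⟨y, rfl⟩ := List.head?_eq_some_iff.1 hv0
        refine ⟨u, y, Or.inr (Or.inr (Or.inl ⟨ih.2 ?_, hu, by simp⟩))⟩
        exact (IsGapWord.collapse ha).2.1 (by simpa using h) hu0
      · refine ⟨u, v, Or.inl ⟨ih.2 ?_, hu, hv, by simp⟩⟩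
        exact (IsGapWord.collapse ha).2.2.2 (by simpa using h) hu0 hv0

lemma sum_map_flatMap_zeroSplits {R : Type*} [CommSemiring R] (W : List (List ℕ))
    (g : List ℕ × List ℕ → List (List ℕ)) (f f' : List ℕ → R) (c : R) (F : ℕ → ℕ → R) (n : ℕ)
    (hn : ∀ w ∈ W, w.count 0 = n) (hF : ∑ i ∈ range n, F i (n - 1 - i) = c)
    (hg : ∀ x y, x ++ 0 :: y ∈ W →
      ((g (x, y)).map f).sum = F (x.count 0) (y.count 0) * f' (x ++ 0 :: y)) :
    ((W.flatMap fun w => (zeroSplits w).flatMap g).map f).sum = c * (W.map f').sum := by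
  rw [List.map_flatMap, List.flatMap, List.sum_flatten, List.map_map, ← List.sum_map_mul_left]
  congr 1
  refine List.map_congr_left fun w hw => ?_
  rw [Function.comp_apply, List.map_flatMap, List.flatMap, List.sum_flatten, List.map_map,
    ← hF, ← hn w hw, ← sum_zeroSplits F w, ← List.sum_map_mul_right]
  congr 1
  refine List.map_congr_left fun s hs => ?_
  have e := mem_zeroSplits.1 hs
  rw [Function.comp_apply]
  conv_rhs => rw [e]
  exact hg _ _ (e ▸ hw)

lemma IsGapWord.ne_nil_iff {k : ℕ} {A x y : List ℕ} (h : IsGapWord A k (x ++ 0 :: y)) :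
    (x ≠ [] ↔ x.count 0 ≠ 0) ∧ (y ≠ [] ↔ y.count 0 ≠ 0) := by
  have h2 := h.head
  have h3 := h.last
  constructor
  · rcases x with _ | ⟨c, x⟩
    · simp
    · obtain rfl : c = 0 := by simpa using h2
      simp
  · rcases List.eq_nil_or_concat y with rfl | ⟨y, c, rfl⟩
    · simp
    · have e : x ++ 0 :: (y ++ [c]) = (x ++ 0 :: y) ++ [c] := by simp
      rw [List.concat_eq_append, e, List.getLast?_concat] at h3
      obtain rfl : c = 0 := by simpa using h3
      simp

lemma IsGapWord.headBelow_right {a k : ℕ} {A x y : List ℕ} (ha : ∀ b ∈ A, a < b)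
    (h : IsGapWord A k (x ++ 0 :: y)) : headBelow a y = 0 := by
  rcases y with _ | ⟨c, y⟩
  · rfl
  have hc := (List.isChain_append.1 h.chain).2.1
  rw [List.isChain_cons_cons] at hc
  have hc0 : c ≠ 0 := by simpa using hc.1
  have := ha c ((h.mem hc0).1 (by simp))
  simp [headBelow, this.le]

lemma gapPoly_cons {R : Type*} [CommSemiring R] (p q t : R) {a : ℕ} {A : List ℕ}
    (hA : (0 :: a :: A).Pairwise (· < ·)) (k : ℕ) :
    gapPoly p q t (a :: A) (k + 1) = (∑ i ∈ range (k + 1), q ^ i * p ^ (k - i)) *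
      (gapPoly p q t A (k + 2) + (1 + t) * gapPoly p q t A (k + 1) + t * gapPoly p q t A k) := by
  have ha : 0 < a := (List.pairwise_cons.1 hA).1 a (by simp)
  have haA : ∀ b ∈ A, a < b := (List.pairwise_cons.1 (List.pairwise_cons.1 hA).2).1
  have hA' : (0 :: A).Pairwise (· < ·) := by
    simp only [List.pairwise_cons, List.mem_cons] at hA ⊢
    exact ⟨fun b hb => hA.1 b (Or.inr hb), hA.2.2⟩
  have hcount : ∀ k, ∀ w ∈ gapWords A k, w.count 0 = k + 1 := fun k w hw =>
    ((mem_gapWords hA').1 hw).count_zero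
  set S := ∑ i ∈ range (k + 1), q ^ i * p ^ (k - i) with hS
  rw [gapPoly, gapWords, List.map_append, List.map_append, List.map_append, List.sum_append,
    List.sum_append, List.sum_append]
  rw [sum_map_flatMap_zeroSplits (gapWords A (k + 2)) _ _ (wordWeight p q t A) S
      (fun i j => if i ≠ 0 ∧ j ≠ 0 then q ^ (i - 1) * p ^ (j - 1) else 0) _ (hcount _) ?_ ?_,
    sum_map_flatMap_zeroSplits (gapWords A (k + 1)) _ _ (wordWeight p q t A) S
      (fun i j => if j ≠ 0 then q ^ i * p ^ (j - 1) else 0) _ (hcount _) ?_ ?_,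
    sum_map_flatMap_zeroSplits (gapWords A (k + 1)) _ _ (wordWeight p q t A) (t * S)
      (fun i j => if i ≠ 0 then q ^ (i - 1) * p ^ j * t else 0) _ (hcount _) ?_ ?_,
    sum_map_flatMap_zeroSplits (gapWords A k) _ _ (wordWeight p q t A) (t * S)
      (fun i j => q ^ i * p ^ j * t) _ (hcount _) ?_ ?_]
  · simp only [gapPoly]
    ring
  · rw [hS, mul_sum]
    refine sum_congr rfl fun i _ => ?_
    rw [Nat.add_sub_cancel]
    ring
  · intro x y hw
    have h := (mem_gapWords hA').1 hw
    rw [List.map_singleton, List.sum_singleton,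
      h.wordWeight_replace p q t haA _ (by simp) (by simp)]
    have h' := (h.insert ha.ne').2.2.2
    have e : x ++ ([0, a, 0] ++ y) = (x ++ [0]) ++ a :: (0 :: y) := by simp
    rw [e] at h' ⊢
    rw [h'.weightAt_min p q t ha haA]
    simp [headBelow, ha]
  · rw [sum_range_succ', hS, mul_sum]
    simp only [ne_eq, not_true_eq_false, if_false, add_zero]
    refine sum_congr rfl fun i _ => ?_
    rw [if_pos (by omega), Nat.add_sub_cancel, show k + 1 + 1 - 1 - (i + 1) = k - i by omega]
    ring
  · intro x y hw
    have h := (mem_gapWords hA').1 hw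
    by_cases hx : x ≠ []
    · rw [if_pos hx, if_pos (h.ne_nil_iff.1.1 hx), List.map_singleton, List.sum_singleton,
        h.wordWeight_replace p q t haA _ (by simp) (by simp)]
      have h' := (h.insert ha.ne').2.2.1 hx
      have e : x ++ ([a, 0] ++ y) = x ++ a :: (0 :: y) := by simp
      rw [e] at h' ⊢
      rw [h'.weightAt_min p q t ha haA]
      simp [headBelow, ha]
    · rw [if_neg hx, if_neg (mt h.ne_nil_iff.1.2 hx)]
      simp
  · rw [sum_range_succ, hS, if_neg (by omega), add_zero]
    refine sum_congr rfl fun i hi => ?_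
    rw [mem_range] at hi
    rw [if_pos (by omega), show k + 1 + 1 - 1 - i - 1 = k - i by omega]
  · intro x y hw
    have h := (mem_gapWords hA').1 hw
    by_cases hy : y ≠ []
    · rw [if_pos hy, if_pos (h.ne_nil_iff.2.1 hy), List.map_singleton, List.sum_singleton,
        h.wordWeight_replace p q t haA _ (by simp) (by simp)]
      have h' := (h.insert ha.ne').2.1 hy
      have e : x ++ ([0, a] ++ y) = (x ++ [0]) ++ a :: y := by simp
      rw [e] at h' ⊢
      rw [h'.weightAt_min p q t ha haA, h.headBelow_right haA]
      simp
    · rw [if_neg hy, if_neg (mt h.ne_nil_iff.2.2 hy)]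
      simp
  · rw [sum_range_succ, sum_range_succ', hS, if_neg (by omega), if_neg (by omega), add_zero,
      add_zero]
    refine sum_congr rfl fun i hi => ?_
    rw [mem_range] at hi
    rw [if_pos (by omega), Nat.add_sub_cancel, show k + 2 + 1 - 1 - (i + 1) - 1 = k - i by omega]
  · intro x y hw
    have h := (mem_gapWords hA').1 hw
    by_cases hxy : x ≠ [] ∧ y ≠ []
    · rw [if_pos hxy, if_pos ⟨h.ne_nil_iff.1.1 hxy.1, h.ne_nil_iff.2.1 hxy.2⟩,
        List.map_singleton, List.sum_singleton,
        h.wordWeight_replace p q t haA _ (by simp) (by simp)]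
      have h' := (h.insert ha.ne').1 hxy.1 hxy.2 (by omega)
      have e : x ++ ([a] ++ y) = x ++ a :: y := by simp
      rw [e] at h' ⊢
      rw [h'.weightAt_min p q t ha haA, h.headBelow_right haA]
      simp
    · rw [if_neg hxy, if_neg (by rw [← h.ne_nil_iff.1, ← h.ne_nil_iff.2]; exact hxy)]
      simp

lemma gapPoly_nil {R : Type*} [CommSemiring R] (p q t : R) (k : ℕ) :
    gapPoly p q t [] k = if k = 0 then 1 else 0 := by
  by_cases h : k = 0 <;> simp [gapPoly, gapWords, wordWeight, h]

lemma gapPoly_cons_zero {R : Type*} [CommSemiring R] (p q t : R) (a : ℕ) (A : List ℕ) :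
    gapPoly p q t (a :: A) 0 = 0 := by
  simp [gapPoly, gapWords]

lemma sum_pow_mul_sq_pow {R : Type*} [CommSemiring R] (q : R) (k : ℕ) :
    ∑ i ∈ range (k + 1), q ^ i * (q ^ 2) ^ (k - i) = ∑ r ∈ range (k + 1), q ^ (r + k) := by
  rw [← sum_range_reflect]
  refine sum_congr rfl fun i hi => ?_
  rw [mem_range] at hi
  rw [← pow_mul, ← pow_add]
  congr 1
  omega

/-- The two recursions are related by a change of unknowns. -/
lemma mul_excPoly {R : Type*} [CommSemiring R] (q u : R) {A : List ℕ}
    (hA : (0 :: A).Pairwise (· < ·)) (h : ℕ) :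
    q * u * excPoly q u A.length h = (∏ i ∈ range h, ∑ r ∈ range (i + 1), q ^ (r + i)) *
      (gapPoly (q ^ 2) q (q * u) A (h + 1) + q * u * gapPoly (q ^ 2) q (q * u) A h) := by
  induction A generalizing h with
  | nil =>
    rw [List.length_nil, excPoly_zero, gapPoly_nil, gapPoly_nil]
    by_cases h0 : h = 0 <;> simp [h0]
  | cons a A ih =>
    have hA' : (0 :: A).Pairwise (· < ·) := by
      simp only [List.pairwise_cons, List.mem_cons] at hA ⊢
      exact ⟨fun b hb => hA.1 b (Or.inr hb), hA.2.2⟩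
    replace ih := ih hA'
    rw [List.length_cons, excPoly_succ]
    rcases h with _ | h
    · rw [gapPoly_cons_zero, gapPoly_cons _ _ _ hA]
      have h0 := ih 0
      have h1 := ih 1
      simp only [prod_range_one, prod_range_zero, zero_add, sum_range_one, one_mul, mul_zero,
        pow_zero, sum_range_zero, add_zero, zero_mul, mul_add] at h0 h1 ⊢
      rw [h0, h1]
      simp
      ring
    · have h0 := ih h
      have h1 := ih (h + 1)
      have h2 := ih (h + 2)
      rw [gapPoly_cons _ _ _ hA, gapPoly_cons _ _ _ hA, sum_pow_mul_sq_pow, sum_pow_mul_sq_pow]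
      set G : ℕ → R := fun i => ∑ r ∈ range (i + 1), q ^ (r + i) with hG
      have e1 : ∑ r ∈ range (h + 1), q ^ (r + (h + 1)) = q * G h := by
        rw [hG, mul_sum]
        exact sum_congr rfl fun r _ => by ring
      have e2 : q ^ (2 * (h + 1)) + q * G h = G (h + 1) := by
        rw [← e1]
        simp only [hG]
        rw [sum_range_succ _ (h + 1), add_comm]
        congr 2
        ring
      simp only [Nat.add_sub_cancel]
      have e3 : ∑ r ∈ range (h + 1), q ^ (r + h) = G h := rfl
      have e4 : ∑ r ∈ range (h + 1 + 1), q ^ (r + (h + 1)) = G (h + 1) := rfl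
      rw [e1, e3, e4]
      calc _ = q * u * excPoly q u A.length (h + 2)
            + (q ^ (2 * (h + 1)) + q * G h + q * u * G h) * (q * u * excPoly q u A.length (h + 1))
            + q * u * G h * G h * (q * u * excPoly q u A.length h) := by ring
        _ = _ := by
          rw [e2, h0, h1, h2, prod_range_succ, prod_range_succ]
          ring

lemma pval_of_mem {n : ℕ} (σ : Equiv.Perm (Fin n)) {i : ℕ} (h : i ∈ Icc 1 n) :
    pval n σ i ∈ Icc 1 n := by
  rw [mem_Icc] at h
  rw [pval, dif_pos h, mem_Icc]
  omega

lemma pval_of_not_mem {n : ℕ} (σ : Equiv.Perm (Fin n)) {i : ℕ} (h : i ∉ Icc 1 n) :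
    pval n σ i = 0 := by
  rw [mem_Icc] at h
  exact dif_neg h

lemma pval_succ {n : ℕ} (σ : Equiv.Perm (Fin n)) (i : Fin n) : pval n σ (i + 1) = σ i + 1 := by
  simp [pval]

lemma pval_injOn {n : ℕ} (σ : Equiv.Perm (Fin n)) {i j : ℕ} (hi : i ∈ Icc 1 n)
    (h : pval n σ i = pval n σ j) : i = j := by
  have hp := mem_Icc.1 (pval_of_mem σ hi)
  have hj : j ∈ Icc 1 n := by
    by_contra hj
    rw [pval_of_not_mem σ hj] at h
    omega
  rw [mem_Icc] at hi hj
  rw [pval, pval, dif_pos hi, dif_pos hj, add_left_inj, Fin.val_inj, σ.injective.eq_iff,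
    Fin.mk.injEq] at h
  omega

/-- The word `σ(1) … σ(n)` with a `0` added at both ends. -/
def paddedWord (n : ℕ) (σ : Equiv.Perm (Fin n)) : List ℕ :=
  (List.range (n + 2)).map (pval n σ)

lemma map_pval_perm {n : ℕ} (σ : Equiv.Perm (Fin n)) :
    ((List.range' 1 n).map (pval n σ)).Perm (List.range' 1 n) := by
  have hmem : ∀ i, i ∈ List.range' 1 n ↔ i ∈ Icc 1 n := by
    intro i
    rw [List.mem_range'_1, mem_Icc]
    omega
  refine List.Subperm.perm_of_length_le (List.subperm_of_subset ?_ ?_) (by simp)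
  · exact List.Nodup.map_on (fun i hi j _ h => pval_injOn σ ((hmem i).1 hi) h)
      List.nodup_range'
  · intro z hz
    obtain ⟨i, hi, rfl⟩ := List.mem_map.1 hz
    exact (hmem _).2 (pval_of_mem σ ((hmem i).1 hi))

lemma paddedWord_eq {n : ℕ} (σ : Equiv.Perm (Fin n)) :
    paddedWord n σ = 0 :: ((List.range' 1 n).map (pval n σ) ++ [0]) := by
  rw [paddedWord, List.range_eq_range', List.range'_succ, List.range'_concat]
  simp [pval]

lemma isGapWord_paddedWord {n : ℕ} (hn : 0 < n) (σ : Equiv.Perm (Fin n)) :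
    IsGapWord (List.range' 1 n) 1 (paddedWord n σ) where
  chain := by
    rw [paddedWord, List.isChain_map]
    refine (List.isChain_range_succ _ _).2 fun m hm => ?_
    by_cases h : m = 0
    · right
      have := mem_Icc.1 (pval_of_mem σ (i := m.succ) (by rw [mem_Icc]; omega))
      omega
    · left
      have := mem_Icc.1 (pval_of_mem σ (i := m) (by rw [mem_Icc]; omega))
      omega
  head := by simp [paddedWord_eq]
  last := by simp [paddedWord_eq, List.getLast?_cons]
  count_zero := by
    rw [paddedWord_eq, List.count_cons, List.count_append, (map_pval_perm σ).count_eq,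
      List.count_eq_zero_of_not_mem (a := 0) (l := List.range' 1 n) (by simp)]
    simp
  count := by
    intro z hz
    rw [paddedWord_eq, List.count_cons_of_ne (Ne.symm hz), List.count_append,
      (map_pval_perm σ).count_eq, List.count_eq_zero_of_not_mem (l := [0]) (by simpa using hz),
      add_zero]

lemma paddedWord_injective (n : ℕ) : Function.Injective (paddedWord n) := by
  intro σ τ h
  ext i
  have := List.map_inj_left.1 h (i + 1) (by simp)
  rwa [pval_succ, pval_succ, add_left_inj] at this

lemma descentsAcross_map_range' (z : ℕ) (f : ℕ → ℕ) (s m : ℕ) :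
    descentsAcross z ((List.range' s m).map f) =
      ((range (m - 1)).filter fun i => z < f (s + i) ∧ f (s + i + 1) < z).card := by
  induction m generalizing s with
  | zero => simp [descentsAcross]
  | succ m ih =>
    rcases m with _ | m
    · simp [descentsAcross]
    rw [List.range'_succ, List.range'_succ, List.map_cons, List.map_cons, descentsAcross,
      ← List.map_cons, ← List.range'_succ, ih]
    simp only [card_filter, Nat.add_sub_cancel]
    rw [sum_range_succ', add_comm]
    simp only [add_zero, add_assoc, add_comm 1]

lemma les_eq_sum (n : ℕ) (σ : Equiv.Perm (Fin n)) :
    les n σ = ∑ j ∈ Icc 1 n, descentsAcross (pval n σ j) ((List.range j).map (pval n σ)) := by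
  simp only [List.range_eq_range', descentsAcross_map_range', zero_add]
  rw [← card_sigma, les]
  refine card_nbij' (fun x => ⟨x.2, x.1 - 1⟩) (fun x => (x.2 + 1, x.1)) ?_ ?_ ?_ ?_
  · rintro ⟨i, j⟩ h
    simp only [coe_filter, mem_product, mem_Icc, Set.mem_ofPred_eq, coe_sigma, Set.mem_sigma_iff,
      mem_coe, mem_range] at h ⊢
    rw [show i - 1 + 1 = i by omega]
    omega
  · rintro ⟨j, i⟩ h
    simp only [coe_filter, mem_product, mem_Icc, Set.mem_ofPred_eq, coe_sigma, Set.mem_sigma_iff,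
      mem_coe, mem_range, Nat.add_sub_cancel] at h ⊢
    have : i ≠ 0 := by
      rintro rfl
      rw [pval_of_not_mem σ (i := 0) (by simp)] at h
      omega
    omega
  · rintro ⟨i, j⟩ h
    simp only [coe_filter, mem_product, mem_Icc, Set.mem_ofPred_eq] at h
    simp only [Prod.mk.injEq, and_true]
    omega
  · rintro ⟨j, i⟩ h
    simp

lemma res_eq_sum (n : ℕ) (σ : Equiv.Perm (Fin n)) :
    res n σ = ∑ j ∈ Icc 1 n, descentsAcross (pval n σ j)
      ((List.range' (j + 1) (n + 1 - j)).map (pval n σ)).reverse := by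
  simp only [← List.map_reverse, List.reverse_range', List.map_map, List.range_eq_range',
    descentsAcross_map_range', zero_add, Function.comp_apply]
  rw [← card_sigma, res]
  refine card_nbij' (fun x => ⟨x.1, n - x.2⟩) (fun x => (x.1, n - x.2)) ?_ ?_ ?_ ?_
  · rintro ⟨i, j⟩ h
    simp only [coe_filter, mem_product, mem_Icc, Set.mem_ofPred_eq, coe_sigma, Set.mem_sigma_iff,
      mem_coe, mem_range] at h ⊢
    rw [show i + 1 + (n + 1 - i) - 1 - (n - j) = j + 1 by omega,
      show i + 1 + (n + 1 - i) - 1 - (n - j + 1) = j by omega]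
    omega
  · rintro ⟨i, j⟩ h
    simp only [coe_filter, mem_product, mem_Icc, Set.mem_ofPred_eq, coe_sigma, Set.mem_sigma_iff,
      mem_coe, mem_range] at h ⊢
    rw [show i + 1 + (n + 1 - i) - 1 - j = n - j + 1 by omega,
      show i + 1 + (n + 1 - i) - 1 - (j + 1) = n - j by omega] at h
    have : j ≠ 0 := by
      rintro rfl
      rw [pval_of_not_mem σ (i := n - 0 + 1) (by simp)] at h
      omega
    omega
  · rintro ⟨i, j⟩ h
    simp only [coe_filter, mem_product, mem_Icc, Set.mem_ofPred_eq] at h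
    simp only [Prod.mk.injEq, true_and]
    omega
  · rintro ⟨i, j⟩ h
    simp only [coe_filter, coe_sigma, Set.mem_sigma_iff, mem_coe, mem_Icc, mem_range,
      Set.mem_ofPred_eq] at h
    simp only [Sigma.mk.injEq, heq_eq_eq, true_and]
    omega

lemma des_eq_sum {n : ℕ} (hn : 0 < n) (σ : Equiv.Perm (Fin n)) :
    des n σ + 1 = ∑ j ∈ Icc 1 n, headBelow (pval n σ j)
      ((List.range' (j + 1) (n + 1 - j)).map (pval n σ)) := by
  obtain ⟨n, rfl⟩ : ∃ m, n = m + 1 := ⟨n - 1, by omega⟩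
  have h : ∀ j ∈ Icc 1 (n + 1), headBelow (pval (n + 1) σ j)
      ((List.range' (j + 1) (n + 1 + 1 - j)).map (pval (n + 1) σ)) =
      if pval (n + 1) σ (j + 1) < pval (n + 1) σ j then 1 else 0 := by
    intro j hj
    rw [mem_Icc] at hj
    rw [show n + 1 + 1 - j = (n + 1 - j) + 1 by omega, List.range'_succ]
    rfl
  rw [sum_congr rfl h, sum_Icc_succ_top (by omega), ← card_filter, if_pos]
  · rfl
  · rw [pval_of_not_mem σ (i := n + 1 + 1) (by simp)]
    have := mem_Icc.1 (pval_of_mem σ (i := n + 1) (by simp))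
    omega

lemma weightAt_paddedWord {R : Type*} [CommSemiring R] (p q t : R) {n j : ℕ}
    (σ : Equiv.Perm (Fin n)) (hj : j ∈ Icc 1 n) :
    weightAt p q t (paddedWord n σ) (pval n σ j) =
      letterWeight p q t (pval n σ j) ((List.range j).map (pval n σ))
        ((List.range' (j + 1) (n + 1 - j)).map (pval n σ)) := by
  have hj' := mem_Icc.1 hj
  have e : List.range (n + 2) = List.range j ++ j :: List.range' (j + 1) (n + 1 - j) := by
    rw [← List.range'_succ, List.range_eq_range', List.range_eq_range']
    have := List.range'_append_1 (s := 0) (m := j) (n := n + 1 - j + 1)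
    rw [zero_add] at this
    rw [this]
    congr 1
    omega
  rw [paddedWord, e, List.map_append, List.map_cons, weightAt_append]
  intro h
  obtain ⟨i, hi, h⟩ := List.mem_map.1 h
  rw [List.mem_range, pval_injOn σ hj h.symm] at hi
  omega

lemma wordWeight_paddedWord {R : Type*} [CommSemiring R] (p q t : R) {n : ℕ} (hn : 0 < n)
    (σ : Equiv.Perm (Fin n)) :
    wordWeight p q t (List.range' 1 n) (paddedWord n σ) =
      q ^ les n σ * p ^ res n σ * t ^ (des n σ + 1) := by
  rw [wordWeight, ← ((map_pval_perm σ).map _).prod_eq, List.map_map]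
  change (∏ j ∈ Icc 1 n, weightAt p q t (paddedWord n σ) (pval n σ j)) = _
  rw [prod_congr rfl fun j hj => weightAt_paddedWord p q t σ hj, les_eq_sum, res_eq_sum,
    des_eq_sum hn]
  simp only [letterWeight, prod_mul_distrib, prod_pow_eq_pow_sum]

lemma sum_Icc_one {M : Type*} [AddCommMonoid M] (n : ℕ) (f : ℕ → M) :
    ∑ i ∈ Icc 1 n, f i = ∑ i : Fin n, f (i + 1) := by
  rw [Fin.sum_univ_eq_sum_range (fun i => f (i + 1)) n, range_eq_Ico, sum_Ico_add' f 0 n 1]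
  exact sum_congr (by ext; simp only [mem_Icc, mem_Ico]; omega) fun _ _ => rfl

lemma inv_eq_finInv {n : ℕ} (σ : Equiv.Perm (Fin n)) : inv n σ = finInv σ := by
  rw [inv, card_filter, sum_product, sum_Icc_one]
  simp only [sum_Icc_one, pval_succ, add_lt_add_iff_right, Fin.val_fin_lt]
  rfl

lemma exc_eq_sum {n : ℕ} (σ : Equiv.Perm (Fin n)) :
    exc n σ = ∑ i, if i < σ i then 1 else 0 := by
  rw [exc, card_filter, sum_Icc_one]
  simp only [pval_succ, add_lt_add_iff_right, Fin.val_fin_lt]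

lemma exists_inversion_of_exc {n : ℕ} (σ : Equiv.Perm (Fin n)) {i : Fin n} (h : i < σ i) :
    ∃ j, i < j ∧ σ j < σ i := by
  by_contra! hc
  have := card_le_card (s := (Ioi i).map σ.toEmbedding) (t := Ioi (σ i)) fun x hx => by
    obtain ⟨j, hj, rfl⟩ := mem_map.1 hx
    rw [mem_Ioi] at hj ⊢
    exact lt_of_le_of_ne (hc j hj) (σ.injective.ne hj.ne)
  rw [card_map, Fin.card_Ioi, Fin.card_Ioi] at this
  omega

lemma exc_le_inv {n : ℕ} (σ : Equiv.Perm (Fin n)) : exc n σ ≤ inv n σ := by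
  rw [exc_eq_sum, inv_eq_finInv, finInv]
  refine sum_le_sum fun i _ => ?_
  split_ifs with h
  · obtain ⟨j, hj⟩ := exists_inversion_of_exc σ h
    calc 1 = if i < j ∧ σ j < σ i then 1 else 0 := (if_pos hj).symm
      _ ≤ _ := single_le_sum (f := fun j => if i < j ∧ σ j < σ i then 1 else 0)
        (fun _ _ => Nat.zero_le _) (mem_univ j)
  · exact Nat.zero_le _

lemma excPoly_right_zero {R : Type*} [CommSemiring R] (q u : R) (n : ℕ) :
    excPoly q u n 0 = ∑ σ : Equiv.Perm (Fin n), q ^ inv n σ * u ^ exc n σ := by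
  refine sum_congr rfl fun σ _ => ?_
  rw [inv_eq_finInv, exc_eq_sum, ← prod_pow_eq_pow_sum]
  congr 1
  refine prod_congr rfl fun i _ => ?_
  simp only [excMatrix, not_lt_zero, false_and, if_false, Fin.val_fin_lt]
  split_ifs <;> simp

lemma pairwise_zero_cons_range' (n : ℕ) : (0 :: List.range' 1 n).Pairwise (· < ·) :=
  List.pairwise_lt_range' (s := 0) (n := n + 1)

lemma sum_inv_exc_eq_gapPoly {R : Type*} [CommSemiring R] (q u : R) {n : ℕ} (hn : 0 < n) :
    q * u * ∑ σ : Equiv.Perm (Fin n), q ^ inv n σ * u ^ exc n σ =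
      gapPoly (q ^ 2) q (q * u) (List.range' 1 n) 1 := by
  have := mul_excPoly q u (pairwise_zero_cons_range' n) 0
  obtain ⟨n, rfl⟩ : ∃ m, n = m + 1 := ⟨n - 1, by omega⟩
  rwa [List.length_range', excPoly_right_zero, prod_range_zero, one_mul, zero_add,
    List.range'_succ, gapPoly_cons_zero, mul_zero, add_zero, ← List.range'_succ] at this

lemma length_gapWords {n : ℕ} (hn : 0 < n) :
    (gapWords (List.range' 1 n) 1).length = Fintype.card (Equiv.Perm (Fin n)) := by
  have h := sum_inv_exc_eq_gapPoly (1 : ℕ) 1 hn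
  have hl : ∀ z w, weightAt (1 : ℕ) 1 1 w z = 1 := fun z w => by simp [weightAt, letterWeight]
  have hw : ∀ A, wordWeight (1 : ℕ) 1 1 A = fun _ => 1 := fun A => by
    funext w
    exact List.prod_eq_one fun x hx => by
      obtain ⟨z, _, rfl⟩ := List.mem_map.1 hx
      exact hl z w
  simpa [gapPoly, hw] using h.symm

lemma gapPoly_eq_sum {R : Type*} [CommSemiring R] (p q t : R) {n : ℕ} (hn : 0 < n) :
    gapPoly p q t (List.range' 1 n) 1 =
      ∑ σ : Equiv.Perm (Fin n), q ^ les n σ * p ^ res n σ * t ^ (des n σ + 1) := by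
  have h : (univ.val.map (paddedWord n) : Multiset (List ℕ)) =
      (gapWords (List.range' 1 n) 1 : Multiset (List ℕ)) := by
    refine Multiset.eq_of_le_of_card_le ?_ ?_
    · rw [Multiset.le_iff_subset (univ.nodup.map (paddedWord_injective n))]
      intro w hw
      obtain ⟨σ, _, rfl⟩ := Multiset.mem_map.1 hw
      exact (mem_gapWords (pairwise_zero_cons_range' n)).2 (isGapWord_paddedWord hn σ)
    · rw [Multiset.coe_card, length_gapWords hn, Multiset.card_map]
      exact le_rfl
  rw [gapPoly, ← Multiset.sum_coe, ← Multiset.map_coe, ← h, Multiset.map_map]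
  exact sum_congr rfl fun σ _ => wordWeight_paddedWord p q t hn σ

/-- `Σ_σ q^(inv σ - exc σ) t^(exc σ) = Σ_σ q^(2·res σ + les σ) t^(des σ)`,
i.e. `S_n(q, t/q) = A_n(q², q, t)`. -/
theorem statement10 (n : ℕ) (hn : 0 < n) :
    (∑ σ : Equiv.Perm (Fin n),
      (X 0 : MvPolynomial (Fin 2) ℤ) ^ (inv n σ - exc n σ) * (X 1) ^ (exc n σ)) =
    ∑ σ : Equiv.Perm (Fin n),
      (X 0 : MvPolynomial (Fin 2) ℤ) ^ (2 * res n σ + les n σ) * (X 1) ^ (des n σ) := by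
  let K := FractionRing (MvPolynomial (Fin 2) ℤ)
  have hinj : Function.Injective (algebraMap (MvPolynomial (Fin 2) ℤ) K) :=
    IsFractionRing.injective _ _
  refine hinj ?_
  simp only [map_sum, map_mul, map_pow]
  set q : K := algebraMap (MvPolynomial (Fin 2) ℤ) K (X 0) with hq
  set t : K := algebraMap (MvPolynomial (Fin 2) ℤ) K (X 1) with ht
  have hq0 : q ≠ 0 := by
    rw [hq, Ne, map_eq_zero_iff _ hinj]
    exact X_ne_zero 0
  have ht0 : t ≠ 0 := by
    rw [ht, Ne, map_eq_zero_iff _ hinj]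
    exact X_ne_zero 1
  have h := (sum_inv_exc_eq_gapPoly q (t / q) hn).trans (gapPoly_eq_sum (q ^ 2) q _ hn)
  rw [mul_div_cancel₀ _ hq0] at h
  refine mul_left_cancel₀ ht0 ?_
  calc _ = t * ∑ σ : Equiv.Perm (Fin n), q ^ inv n σ * (t / q) ^ exc n σ := by
        congr 1
        refine sum_congr rfl fun σ _ => ?_
        rw [div_pow, pow_sub₀ _ hq0 (exc_le_inv σ)]
        ring
    _ = _ := by
        rw [h, mul_sum]
        refine sum_congr rfl fun σ _ => ?_
        ring
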